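/- arXiv:2603.00428 — 2 statements merged into one kernel-verified Lean document; each statement's English description precedes it below -/
import Mathlib

section
/- For integers β ≥ 1 and Δ ≥ 1, the maximum number of edges of a simple graph with matching number at most β and maximum degree at most Δ equals Δβ + ⌊Δ/2⌋·⌊β/⌈Δ/2⌉⌋, and in particular this quantity is at most Δβ + β. -/
namespace SimpleGraph

/-- `G` has matching number at most `β` and maximum degree at most `Δ`. -/
def MatchingDegreeBounded {V : Type*} (G : SimpleGraph V) (β Δ : ℕ) : Prop :=
  (∀ M : Finset (Sym2 V), (M : Set (Sym2 V)) ⊆ G.edgeSet →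
    ((M : Set (Sym2 V)).Pairwise fun e f => ∀ v, ¬(v ∈ e ∧ v ∈ f)) → M.card ≤ β) ∧
  ∀ v, (G.neighborSet v).ncard ≤ Δ

/-- Some finite graph with matching number at most `β` and maximum degree at most `Δ` has at least
`m` edges. -/
def EdgesAttainable (β Δ m : ℕ) : Prop :=
  ∃ (V : Type) (_ : Finite V) (G : SimpleGraph V),
    G.MatchingDegreeBounded β Δ ∧ m ≤ G.edgeSet.ncard

lemma two_mul_card_le_of_pairwise_disjoint {V : Type*} [Fintype V] {G : SimpleGraph V}
    {M : Finset (Sym2 V)} (hMG : (M : Set (Sym2 V)) ⊆ G.edgeSet)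
    (hM : (M : Set (Sym2 V)).Pairwise fun e f => ∀ v, ¬(v ∈ e ∧ v ∈ f)) :
    2 * M.card ≤ Fintype.card V := by
  classical
  have h1 : (M.biUnion Sym2.toFinset).card = ∑ e ∈ M, e.toFinset.card := by
    refine Finset.card_biUnion fun e he f hf hef => ?_
    rw [Function.onFun, Finset.disjoint_left]
    intro v hv hv'
    exact hM he hf hef v ⟨Sym2.mem_toFinset.1 hv, Sym2.mem_toFinset.1 hv'⟩
  have h2 : ∑ e ∈ M, e.toFinset.card = ∑ e ∈ M, 2 :=
    Finset.sum_congr rfl fun e he =>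
      Sym2.card_toFinset_of_not_isDiag e (G.not_isDiag_of_mem_edgeSet (hMG he))
  rw [Finset.sum_const, smul_eq_mul] at h2
  have := Finset.card_le_univ (M.biUnion Sym2.toFinset)
  lia

lemma card_preimage_map_le {V W : Type*} {G : SimpleGraph V} {β Δ : ℕ}
    (hG : G.MatchingDegreeBounded β Δ) {f : V → W} (hf : f.Injective) {M : Finset (Sym2 W)}
    (hMG : ∀ e, e.map f ∈ M → e ∈ G.edgeSet)
    (hM : (M : Set (Sym2 W)).Pairwise fun e f => ∀ v, ¬(v ∈ e ∧ v ∈ f)) :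
    (M.preimage (Sym2.map f) (Sym2.map.injective hf).injOn).card ≤ β := by
  refine hG.1 _ (fun e he => hMG e (by simpa using he)) fun e he e' he' hee' v hv => ?_
  refine hM (by simpa using he) (by simpa using he') ((Sym2.map.injective hf).ne hee') (f v) ?_
  exact ⟨Sym2.mem_map.2 ⟨v, hv.1, rfl⟩, Sym2.mem_map.2 ⟨v, hv.2, rfl⟩⟩

lemma MatchingDegreeBounded.sum {V W : Type*} {G : SimpleGraph V} {H : SimpleGraph W}
    {β γ Δ : ℕ} (hG : G.MatchingDegreeBounded β Δ) (hH : H.MatchingDegreeBounded γ Δ) :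
    (G ⊕g H).MatchingDegreeBounded (β + γ) Δ := by
  classical
  refine ⟨fun M hMG hM => ?_, ?_⟩
  · have h1 := card_preimage_map_le hG (f := (Sum.inl : V → V ⊕ W)) Sum.inl_injective (M := M)
      (fun e he => by have := hMG he; induction e; simpa using this) hM
    have h2 := card_preimage_map_le hH (f := (Sum.inr : W → V ⊕ W)) Sum.inr_injective (M := M)
      (fun e he => by have := hMG he; induction e; simpa using this) hM
    refine le_trans ?_ (add_le_add h1 h2)
    rw [← Finset.card_image_of_injective (M.preimage _ _)
        (Sym2.map.injective (Sum.inl_injective : (Sum.inl : V → V ⊕ W).Injective)),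
      ← Finset.card_image_of_injective (M.preimage _ _)
        (Sym2.map.injective (Sum.inr_injective : (Sum.inr : W → V ⊕ W).Injective))]
    refine le_trans (Finset.card_le_card fun e he => ?_) (Finset.card_union_le _ _)
    have := hMG he
    induction e with | _ a b
    rw [Finset.mem_union, Finset.mem_image, Finset.mem_image]
    rcases a with a | a <;> rcases b with b | b
    · exact .inl ⟨s(a, b), by simpa using he, rfl⟩
    · simp at this
    · simp at this
    · exact .inr ⟨s(a, b), by simpa using he, rfl⟩
  · rintro (v | v)
    · rw [neighborSet_sum_inl, Set.ncard_image_of_injective _ Sum.inl_injective]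
      exact hG.2 v
    · rw [neighborSet_sum_inr, Set.ncard_image_of_injective _ Sum.inr_injective]
      exact hH.2 v

lemma MatchingDegreeBounded.iso {V W : Type*} {G : SimpleGraph V} {H : SimpleGraph W}
    {β Δ : ℕ} (hG : G.MatchingDegreeBounded β Δ) (φ : G ≃g H) :
    H.MatchingDegreeBounded β Δ := by
  classical
  refine ⟨fun M hMG hM => ?_, fun w => ?_⟩
  · have h1 := card_preimage_map_le hG φ.injective (M := M)
      (fun e he => by
        have := hMG he
        induction e with | _ a b
        exact φ.map_adj_iff.1 this) hM
    rwa [← Finset.card_image_of_injective (M.preimage _ _) (Sym2.map.injective φ.injective),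
      Finset.image_preimage, Finset.filter_true_of_mem] at h1
    intro e _
    induction e with | _ a b
    exact ⟨s(φ.symm a, φ.symm b), by simp⟩
  · rw [← Nat.card_coe_set_eq, ← Nat.card_congr (φ.symm.mapNeighborSet w).symm]
    exact hG.2 _

lemma EdgesAttainable.add {β γ Δ m k : ℕ} (h : EdgesAttainable β Δ m)
    (h' : EdgesAttainable γ Δ k) : EdgesAttainable (β + γ) Δ (m + k) := by
  obtain ⟨V, _, G, hG, hm⟩ := h
  obtain ⟨W, _, H, hH, hk⟩ := h'
  refine ⟨V ⊕ W, inferInstance, G ⊕g H, hG.sum hH, ?_⟩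
  rw [← Nat.card_coe_set_eq, Nat.card_congr edgeSetSumEquiv, Nat.card_sum, Nat.card_coe_set_eq,
    Nat.card_coe_set_eq]
  exact add_le_add hm hk

lemma EdgesAttainable.zero (Δ : ℕ) : EdgesAttainable 0 Δ 0 := by
  refine ⟨Empty, inferInstance, ⊥, ⟨fun M _ _ => ?_, fun v => v.elim⟩, Nat.zero_le _⟩
  simp [Finset.eq_empty_of_isEmpty M]

lemma EdgesAttainable.mul {β Δ m : ℕ} (h : EdgesAttainable β Δ m) (q : ℕ) :
    EdgesAttainable (q * β) Δ (q * m) := by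
  induction q with
  | zero => simpa using EdgesAttainable.zero Δ
  | succ q ih => simpa [add_mul] using ih.add h

lemma edgesAttainable_starGraph (Δ : ℕ) : EdgesAttainable 1 Δ Δ := by
  refine ⟨Fin (Δ + 1), inferInstance, starGraph 0, ⟨fun M hMG hM => ?_, fun v => ?_⟩, ?_⟩
  · have hc (e) (he : e ∈ M) : (0 : Fin (Δ + 1)) ∈ e := by
      have := hMG he
      induction e with | _ a b
      rw [mem_edgeSet, starGraph_adj] at this
      rw [Sym2.mem_iff]
      exact this.2.imp Eq.symm Eq.symm
    rw [Finset.card_le_one]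
    intro e he f hf
    by_contra hef
    exact hM he hf hef 0 ⟨hc e he, hc f hf⟩
  · rw [← Nat.card_coe_set_eq, Nat.card_eq_fintype_card, card_neighborSet_eq_degree]
    have := (starGraph (0 : Fin (Δ + 1))).degree_lt_card_verts v
    rw [Fintype.card_fin] at this
    lia
  · have := (isTree_starGraph (0 : Fin (Δ + 1))).card_edgeFinset
    rw [← coe_edgeFinset, Set.ncard_coe_finset]
    rw [Fintype.card_fin] at this
    lia

lemma two_mul_card_edgeFinset_top (n : ℕ) :
    (⊤ : SimpleGraph (Fin n)).edgeFinset.card * 2 = n * (n - 1) := by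
  rw [card_edgeFinset_top_eq_card_choose_two, Fintype.card_fin, Nat.choose_two_right]
  exact Nat.div_mul_cancel (Nat.even_mul_pred_self n).two_dvd

lemma edgesAttainable_even {c : ℕ} : EdgesAttainable c (2 * c) (2 * c * c + c) := by
  refine ⟨Fin (2 * c + 1), inferInstance, ⊤, ⟨fun M hMG hM => ?_, fun v => ?_⟩, ?_⟩
  · have := two_mul_card_le_of_pairwise_disjoint hMG hM
    rw [Fintype.card_fin] at this
    lia
  · rw [← Nat.card_coe_set_eq, Nat.card_eq_fintype_card, card_neighborSet_eq_degree]
    simp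
  · have := two_mul_card_edgeFinset_top (2 * c + 1)
    rw [← coe_edgeFinset, Set.ncard_coe_finset]
    rw [Nat.add_sub_cancel] at this
    nlinarith

lemma edgesAttainable_odd {c : ℕ} :
    EdgesAttainable (c + 1) (2 * c + 1) ((2 * c + 1) * (c + 1) + c) := by
  classical
  let p (i : ℕ) : Fin (2 * (c + 1) + 1) := Fin.ofNat _ i
  let s : Finset (Sym2 (Fin (2 * (c + 1) + 1))) :=
    (Finset.range (c + 2)).image fun i => s(p (2 * i), p (2 * i + 1))
  refine ⟨Fin (2 * (c + 1) + 1), inferInstance, (⊤ : SimpleGraph _).deleteEdges s,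
    ⟨fun M hMG hM => ?_, fun v => ?_⟩, ?_⟩
  · have := two_mul_card_le_of_pairwise_disjoint hMG hM
    rw [Fintype.card_fin] at this
    lia
  · obtain ⟨w, hw, hvw⟩ : ∃ w, w ≠ v ∧ s(v, w) ∈ s := by
      have hp : p v = v := by simp [p]
      have hne (i : ℕ) (hi : i < 2 * (c + 1) + 1) : p (i + 1) ≠ p i := by
        intro h
        have := congrArg Fin.val h
        simp only [p, Fin.ofNat, Nat.mod_eq_of_lt hi] at this
        rcases Nat.lt_or_ge (i + 1) (2 * (c + 1) + 1) with h' | h'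
        · rw [Nat.mod_eq_of_lt h'] at this
          lia
        · rw [show i + 1 = 2 * (c + 1) + 1 by lia, Nat.mod_self] at this
          lia
      rcases Nat.even_or_odd' v.val with ⟨k, hk | hk⟩
      · refine ⟨p (2 * k + 1), ?_, Finset.mem_image.2 ⟨k, by grind, ?_⟩⟩
        · rw [← hp, hk]
          exact hne _ (by lia)
        · rw [← hk, hp]
      · refine ⟨p (2 * k), ?_, Finset.mem_image.2 ⟨k, by grind, ?_⟩⟩
        · rw [← hp, hk]
          exact (hne _ (by lia)).symm
        · rw [← hk, hp, Sym2.eq_swap]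
    have hsub : ((⊤ : SimpleGraph _).deleteEdges (s : Set (Sym2 _))).neighborSet v ⊆
        ((({v, w} : Finset _)ᶜ : Finset (Fin (2 * (c + 1) + 1))) : Set _) := by
      intro u hu
      rw [mem_neighborSet, deleteEdges_adj, top_adj] at hu
      simp only [Finset.coe_compl, Finset.coe_insert, Finset.coe_singleton, Set.mem_compl_iff,
        Set.mem_insert_iff, Set.mem_singleton_iff, not_or]
      exact ⟨hu.1.symm, fun h => hu.2 (h ▸ hvw)⟩
    refine (Set.ncard_le_ncard hsub (Set.toFinite _)).trans ?_
    rw [Set.ncard_coe_finset, Finset.card_compl, Finset.card_pair hw.symm, Fintype.card_fin]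
    lia
  · have := two_mul_card_edgeFinset_top (2 * (c + 1) + 1)
    have hs : s.card ≤ c + 2 := Finset.card_image_le.trans (Finset.card_range _).le
    rw [← coe_edgeFinset, Set.ncard_coe_finset, edgeFinset_deleteEdges]
    refine le_trans ?_ (Finset.le_card_sdiff _ _)
    rw [Nat.add_sub_cancel] at this
    apply Nat.le_sub_of_add_le
    nlinarith

lemma edgesAttainable_extremal (β Δ : ℕ) :
    EdgesAttainable β Δ (Δ * β + Δ / 2 * (β / ((Δ + 1) / 2))) := by
  have hblock : EdgesAttainable ((Δ + 1) / 2) Δ (Δ * ((Δ + 1) / 2) + Δ / 2) := by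
    rcases Nat.even_or_odd' Δ with ⟨k, rfl | rfl⟩
    · rw [show (2 * k + 1) / 2 = k by lia, show 2 * k / 2 = k by lia]
      exact edgesAttainable_even
    · rw [show (2 * k + 1 + 1) / 2 = k + 1 by lia, show (2 * k + 1) / 2 = k by lia]
      exact edgesAttainable_odd
  have h := (hblock.mul (β / ((Δ + 1) / 2))).add
    ((edgesAttainable_starGraph Δ).mul (β % ((Δ + 1) / 2)))
  have hβ := Nat.div_add_mod' β ((Δ + 1) / 2)
  rw [mul_one, hβ] at h
  convert h using 1
  nth_rw 1 [← hβ]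
  ring

lemma card_edgeFinset_le_of_degree_le {V : Type*} [Fintype V] (G : SimpleGraph V)
    [DecidableRel G.Adj] {Δ : ℕ} (hΔ : ∀ v, G.degree v ≤ Δ) :
    G.edgeFinset.card ≤ Δ * (Fintype.card V / 2) +
      if (Δ + 1) / 2 ≤ Fintype.card V / 2 then Δ / 2 else 0 := by
  classical
  have hsum := G.sum_degrees_eq_twice_card_edges
  have h1 : ∑ v, G.degree v ≤ Fintype.card V * Δ := by
    simpa using Finset.sum_le_card_nsmul Finset.univ _ _ fun v _ => hΔ v
  have h2 : ∑ v, G.degree v ≤ Fintype.card V * (Fintype.card V - 1) := by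
    simpa using Finset.sum_le_card_nsmul Finset.univ _ _
      fun v _ => Nat.le_sub_one_of_lt (G.degree_lt_card_verts v)
  rw [hsum] at h1 h2
  generalize Fintype.card V = n at *
  rcases Nat.even_or_odd' n with ⟨b, rfl | rfl⟩
  · rw [show 2 * b / 2 = b by lia]
    apply le_add_right
    nlinarith
  · rw [show (2 * b + 1) / 2 = b by lia]
    split_ifs with h
    · have : (2 * b + 1) * Δ = 2 * (Δ * b) + Δ := by ring
      lia
    · rw [Nat.add_sub_cancel] at h2
      have : (2 * b + 1) * b ≤ Δ * b := Nat.mul_le_mul_right _ (by lia)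
      nlinarith

lemma card_edgeFinset_eq_sum_connectedComponent {V : Type*} [Fintype V] (G : SimpleGraph V)
    [DecidableRel G.Adj] [Fintype G.ConnectedComponent]
    [∀ C : G.ConnectedComponent, Fintype C.supp]
    [∀ C : G.ConnectedComponent, DecidableRel (G.induce C.supp).Adj] :
    G.edgeFinset.card = ∑ C : G.ConnectedComponent, (G.induce C.supp).edgeFinset.card := by
  classical
  refine Nat.eq_of_mul_eq_mul_left two_pos ?_
  rw [← sum_degrees_eq_twice_card_edges, Finset.mul_sum,
    ← Fintype.sum_fiberwise G.connectedComponentMk (fun v => G.degree v)]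
  refine Fintype.sum_congr _ _ fun C => ?_
  rw [← sum_degrees_eq_twice_card_edges]
  refine Fintype.sum_equiv (Equiv.subtypeEquivRight fun v => (C.mem_supp_iff v).symm) _ _
    fun v => ?_
  have h := degree_induce_of_neighborSet_subset (G := G) (s := C.supp) (v := ⟨v.1, v.2⟩)
    fun w hw => (C.mem_supp_congr_adj hw).1 v.2
  convert h.symm
  rfl

lemma card_eq_sum_connectedComponent {V : Type*} [Fintype V] (G : SimpleGraph V)
    [Fintype G.ConnectedComponent] [∀ C : G.ConnectedComponent, Fintype C.supp] :
    Fintype.card V = ∑ C : G.ConnectedComponent, Fintype.card C.supp := by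
  rw [← Fintype.card_sigma]
  exact Fintype.card_congr (Equiv.sigmaFiberEquiv G.connectedComponentMk).symm

/-- The edge bound for a graph with many odd components. -/
lemma card_edgeFinset_le_of_oddComponents {V : Type*} [Fintype V] (G : SimpleGraph V)
    [DecidableRel G.Adj] {b Δ : ℕ} (hΔ : ∀ v, G.degree v ≤ Δ)
    (hodd : Fintype.card V ≤ 2 * b + G.oddComponents.ncard) (h1 : 1 ≤ Δ) :
    G.edgeFinset.card ≤ Δ * b + Δ / 2 * (b / ((Δ + 1) / 2)) := by
  classical
  have hcard := G.card_eq_sum_connectedComponent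
  have hk : G.oddComponents.ncard = ∑ C : G.ConnectedComponent, Fintype.card C.supp % 2 := by
    rw [Set.ncard_eq_toFinset_card', Finset.card_eq_sum_ones, Set.toFinset_ofPred,
      Finset.sum_filter]
    refine Fintype.sum_congr _ _ fun C => ?_
    rw [← Nat.card_coe_set_eq, Nat.card_eq_fintype_card]
    split_ifs with h
    · exact (Nat.odd_iff.1 h).symm
    · exact (Nat.even_iff.1 (Nat.not_odd_iff_even.1 h)).symm
  have hb : ∑ C : G.ConnectedComponent, Fintype.card C.supp / 2 ≤ b := by
    have : ∑ C : G.ConnectedComponent, Fintype.card C.supp =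
        2 * ∑ C : G.ConnectedComponent, Fintype.card C.supp / 2 +
          ∑ C : G.ConnectedComponent, Fintype.card C.supp % 2 := by
      rw [Finset.mul_sum, ← Finset.sum_add_distrib]
      exact Fintype.sum_congr _ _ fun C => (Nat.div_add_mod _ 2).symm
    lia
  set c := (Δ + 1) / 2 with hc
  let big : Finset G.ConnectedComponent := {C | c ≤ Fintype.card C.supp / 2}
  have hbig : big.card ≤ b / c := by
    rw [Nat.le_div_iff_mul_le (by lia)]
    calc big.card * c = ∑ C ∈ big, c := by rw [Finset.sum_const, smul_eq_mul]
      _ ≤ ∑ C ∈ big, Fintype.card C.supp / 2 :=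
        Finset.sum_le_sum fun C hC => (Finset.mem_filter.1 hC).2
      _ ≤ ∑ C : G.ConnectedComponent, Fintype.card C.supp / 2 :=
        Finset.sum_le_sum_of_subset (Finset.subset_univ _)
      _ ≤ b := hb
  calc G.edgeFinset.card
      = ∑ C : G.ConnectedComponent, (G.induce C.supp).edgeFinset.card :=
        G.card_edgeFinset_eq_sum_connectedComponent
    _ ≤ ∑ C : G.ConnectedComponent, (Δ * (Fintype.card C.supp / 2) +
          if c ≤ Fintype.card C.supp / 2 then Δ / 2 else 0) := by
        refine Finset.sum_le_sum fun C _ => card_edgeFinset_le_of_degree_le _ fun v => ?_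
        exact ((Embedding.induce C.supp).toCopy.degree_le v).trans (hΔ _)
    _ = Δ * (∑ C : G.ConnectedComponent, Fintype.card C.supp / 2) + Δ / 2 * big.card := by
        rw [Finset.sum_add_distrib, ← Finset.mul_sum, ← Finset.sum_filter, Finset.sum_const,
          smul_eq_mul, mul_comm (Finset.card _)]
    _ ≤ Δ * b + Δ / 2 * (b / c) := by gcongr

lemma Iso.ncard_oddComponents_eq {V W : Type*} {G : SimpleGraph V} {H : SimpleGraph W}
    (φ : G ≃g H) : G.oddComponents.ncard = H.oddComponents.ncard := by
  rw [← Set.ncard_image_of_injective _ φ.connectedComponentEquiv.injective,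
    Equiv.image_eq_preimage_symm]
  congr 1
  ext C
  obtain ⟨C, rfl⟩ := φ.connectedComponentEquiv.surjective C
  simp only [Set.mem_preimage, Equiv.symm_apply_apply, Set.mem_ofPred_eq, ← Nat.card_coe_set_eq]
  rw [Nat.card_congr (ConnectedComponent.isoEquivSupp φ C)]

/-- The join of `G` with a complete graph on `d` new vertices. -/
abbrev joinComplete {V : Type*} (G : SimpleGraph V) (d : ℕ) : SimpleGraph (V ⊕ Fin d) :=
  (G ⊕g ⊤) ⊔ completeBipartiteGraph V (Fin d)

lemma joinComplete_adj_inr {V : Type*} (G : SimpleGraph V) (d : ℕ) (i : Fin d) (x : V ⊕ Fin d)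
    (hx : x ≠ .inr i) : (G.joinComplete d).Adj (.inr i) x := by
  rcases x with x | x
  · simp
  · simpa [eq_comm] using hx

/-- A perfect matching of the join of `G` with `d` new vertices yields a large matching of `G`. -/
lemma card_le_of_joinComplete_isPerfectMatching {V : Type*} [Fintype V] {G : SimpleGraph V}
    {β d : ℕ} (hβ : ∀ M : Finset (Sym2 V), (M : Set (Sym2 V)) ⊆ G.edgeSet →
      ((M : Set (Sym2 V)).Pairwise fun e f => ∀ v, ¬(v ∈ e ∧ v ∈ f)) → M.card ≤ β)
    {P : (G.joinComplete d).Subgraph} (hP : P.IsPerfectMatching) :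
    Fintype.card V ≤ 2 * β + d := by
  classical
  rw [Subgraph.isPerfectMatching_iff] at hP
  let M : Finset (Sym2 V) := {e | e.map Sum.inl ∈ P.edgeSet}
  have hMG : (M : Set (Sym2 V)) ⊆ G.edgeSet := by
    intro e he
    induction e with | _ a b
    have : P.Adj (.inl a) (.inl b) := by simpa [M] using he
    simpa using this.adj_sub
  have hM : (M : Set (Sym2 V)).Pairwise fun e f => ∀ v, ¬(v ∈ e ∧ v ∈ f) := by
    rintro e he f hf hef v ⟨⟨a, rfl⟩, ⟨b, rfl⟩⟩
    have ha : P.Adj (.inl v) (.inl a) := by simpa [M] using he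
    have hb : P.Adj (.inl v) (.inl b) := by simpa [M] using hf
    exact hef (by rw [Sum.inl_injective ((hP _).unique ha hb)])
  choose f hf using fun x => (hP x).exists
  have hcover : (Finset.univ : Finset V) ⊆ M.biUnion Sym2.toFinset ∪
      Finset.univ.filter (fun v : V => ∃ i, f (.inl v) = .inr i) := by
    intro v _
    rw [Finset.mem_union, Finset.mem_biUnion]
    rcases h : f (.inl v) with w | i
    · refine .inl ⟨s(v, w), ?_, by simp⟩
      simpa [M] using h ▸ hf (.inl v)
    · exact .inr (by simp [h])
  have h1 : (M.biUnion Sym2.toFinset).card ≤ M.card * 2 := by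
    refine Finset.card_biUnion_le_card_mul _ _ _ fun e he => ?_
    rw [Sym2.card_toFinset_of_not_isDiag e (G.not_isDiag_of_mem_edgeSet (hMG he))]
  have h2 : (Finset.univ.filter fun v : V => ∃ i, f (.inl v) = .inr i).card ≤ d := by
    have hd : (Finset.univ.image (Sum.inr : Fin d → V ⊕ Fin d)).card = d := by
      rw [Finset.card_image_of_injective _ Sum.inr_injective, Finset.card_univ, Fintype.card_fin]
    refine le_of_le_of_eq ?_ hd
    refine Finset.card_le_card_of_injOn (fun v => f (.inl v)) (fun v hv => ?_) ?_
    · obtain ⟨i, hi⟩ := (Finset.mem_filter.1 hv).2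
      simp [hi]
    · intro v _ w _ hvw
      have h3 : P.Adj (f (.inl v)) (.inl v) := (hf _).symm
      have h4 : P.Adj (f (.inl v)) (.inl w) := by
        have : f (.inl v) = f (.inl w) := hvw
        exact this ▸ (hf _).symm
      exact Sum.inl_injective ((hP _).unique h3 h4)
  have h5 := Finset.card_le_card hcover
  have h6 := Finset.card_union_le (M.biUnion Sym2.toFinset)
    (Finset.univ.filter fun v : V => ∃ i, f (.inl v) = .inr i)
  have h7 := hβ M hMG hM
  rw [Finset.card_univ] at h5
  lia

/-- The nontrivial direction of the **Tutte–Berge formula**. -/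
lemma exists_card_add_ncard_le_oddComponents {V : Type*} [Fintype V] {G : SimpleGraph V} {β : ℕ}
    (hβ : ∀ M : Finset (Sym2 V), (M : Set (Sym2 V)) ⊆ G.edgeSet →
      ((M : Set (Sym2 V)).Pairwise fun e f => ∀ v, ¬(v ∈ e ∧ v ∈ f)) → M.card ≤ β) :
    ∃ S : Set V, Fintype.card V + S.ncard ≤ 2 * β + (G.induce Sᶜ).oddComponents.ncard := by
  classical
  have hpar (S : Set V) : (G.induce Sᶜ).oddComponents.ncard % 2 =
      (Fintype.card V + S.ncard) % 2 := by
    have h := odd_ncard_oddComponents (G := G.induce Sᶜ)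
    have h' := Set.ncard_add_ncard_compl S
    rw [Nat.card_coe_set_eq] at h
    rw [Nat.card_eq_fintype_card] at h'
    grind
  by_contra! hcon
  have h0 := hcon ∅
  have hp0 := hpar ∅
  rw [Set.ncard_empty] at h0 hp0
  obtain ⟨d, hd⟩ : ∃ d, Fintype.card V = 2 * β + 2 + d := Nat.exists_eq_add_of_le (by lia)
  have hno : ¬∃ P : (G.joinComplete d).Subgraph, P.IsPerfectMatching := by
    rintro ⟨P, hP⟩
    have := card_le_of_joinComplete_isPerfectMatching hβ hP
    lia
  rw [tutte] at hno
  push Not at hno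
  obtain ⟨U, hU⟩ := hno
  rw [IsTutteViolator] at hU
  by_cases hsub : Set.range Sum.inr ⊆ U
  · let S : Set V := Sum.inl ⁻¹' U
    have hUcard : U.ncard = S.ncard + d := by
      have hUS : U = Sum.inl '' S ∪ Set.range Sum.inr := by
        ext (v | i)
        · simp [S]
        · simpa using hsub ⟨i, rfl⟩
      rw [hUS, Set.ncard_union_eq (by
          rw [Set.disjoint_left]
          rintro _ ⟨v, _, rfl⟩ ⟨i, hi⟩
          cases hi),
        Set.ncard_image_of_injective _ Sum.inl_injective, ← Set.image_univ,
        Set.ncard_image_of_injective _ Sum.inr_injective, Set.ncard_univ, Nat.card_fin]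
    let φ : G.induce Sᶜ ≃g ((⊤ : (G.joinComplete d).Subgraph).deleteVerts U).coe :=
      { toEquiv := Equiv.ofBijective (fun v => ⟨.inl v.1, trivial, v.2⟩) ⟨by
            rintro ⟨v, hv⟩ ⟨w, hw⟩ h
            exact Subtype.ext (Sum.inl_injective (congrArg Subtype.val h)), by
            rintro ⟨v | i, h⟩
            · exact ⟨⟨v, by simpa [S] using h⟩, rfl⟩
            · exact absurd (hsub ⟨i, rfl⟩) (by simpa using h)⟩
        map_rel_iff' := by
          rintro ⟨v, hv⟩ ⟨w, hw⟩
          have hv' : Sum.inl v ∉ U := hv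
          have hw' : Sum.inl w ∉ U := hw
          change ((⊤ : (G.joinComplete d).Subgraph).deleteVerts U).Adj (.inl v) (.inl w) ↔ G.Adj v w
          rw [Subgraph.deleteVerts_adj]
          simp [hv', hw'] }
    rw [← φ.ncard_oddComponents_eq, hUcard] at hU
    have := hcon S
    have := hpar S
    lia
  · obtain ⟨_, ⟨i, rfl⟩, hi⟩ := Set.not_subset.1 hsub
    set H := ((⊤ : (G.joinComplete d).Subgraph).deleteVerts U).coe with hH
    have hodd : H.oddComponents.ncard ≤ 1 := by
      have hmem : Sum.inr i ∈ ((⊤ : (G.joinComplete d).Subgraph).deleteVerts U).verts := by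
        simpa using hi
      have : H.Connected := by
        refine .of_isUniversal (v := ⟨Sum.inr i, hmem⟩) ?_
        rintro ⟨x, hx⟩ hne
        have hadj := G.joinComplete_adj_inr d i x (by simpa [eq_comm] using hne)
        have hx' : x ∉ U := by simpa using hx
        rw [hH, Subgraph.coe_adj, Subgraph.deleteVerts_adj]
        exact ⟨trivial, hi, trivial, hx', hadj⟩
      have := this.preconnected.subsingleton_connectedComponent
      exact Set.ncard_le_one_of_subsingleton _
    have hU0 : U = ∅ := by
      rw [← Set.ncard_eq_zero (Set.toFinite U)]
      lia
    have h1 : Odd H.oddComponents.ncard := by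
      rw [show H.oddComponents.ncard = 1 by lia]
      exact odd_one
    rw [odd_ncard_oddComponents, Nat.card_coe_set_eq] at h1
    subst hU0
    simp only [Subgraph.deleteVerts_empty, Subgraph.verts_top, Set.ncard_univ,
      Nat.card_eq_fintype_card, Fintype.card_sum, Fintype.card_fin] at h1
    rw [Nat.odd_iff] at h1
    lia

lemma card_edgeFinset_le_induce_compl {V : Type*} [Fintype V] [DecidableEq V] (G : SimpleGraph V)
    [DecidableRel G.Adj] {Δ : ℕ} (hΔ : ∀ v, G.degree v ≤ Δ) (S : Set V) [DecidablePred (· ∈ S)] :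
    G.edgeFinset.card ≤ Δ * S.ncard + (G.induce Sᶜ).edgeFinset.card := by
  have hsub : G.edgeFinset ⊆ S.toFinset.biUnion (fun v => G.incidenceFinset v) ∪
      (G.induce Sᶜ).edgeFinset.image (Sym2.map Subtype.val) := by
    intro e he
    induction e with | _ a b
    rw [mem_edgeFinset, mem_edgeSet] at he
    rw [Finset.mem_union, Finset.mem_biUnion, Finset.mem_image]
    by_cases ha : a ∈ S
    · exact .inl ⟨a, by simpa using ha, by simpa [mem_incidenceSet] using he⟩
    by_cases hb : b ∈ S
    · exact .inl ⟨b, by simpa using hb, by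
        rw [Sym2.eq_swap]
        simpa [mem_incidenceSet] using he.symm⟩
    · exact .inr ⟨s(⟨a, ha⟩, ⟨b, hb⟩), by simpa using he, rfl⟩
  refine (Finset.card_le_card hsub).trans ((Finset.card_union_le _ _).trans ?_)
  refine add_le_add ?_ Finset.card_image_le
  rw [Set.ncard_eq_toFinset_card', mul_comm]
  refine Finset.card_biUnion_le_card_mul _ _ _ fun v _ => ?_
  rw [card_incidenceFinset_eq_degree]
  exact hΔ v

lemma card_edgeFinset_le_of_matching_of_degree {V : Type*} [Fintype V] [DecidableEq V]
    (G : SimpleGraph V) [DecidableRel G.Adj] {β Δ : ℕ} (h1 : 1 ≤ Δ)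
    (hβ : ∀ M : Finset (Sym2 V), (M : Set (Sym2 V)) ⊆ G.edgeSet →
      ((M : Set (Sym2 V)).Pairwise fun e f => ∀ v, ¬(v ∈ e ∧ v ∈ f)) → M.card ≤ β)
    (hΔ : ∀ v, G.degree v ≤ Δ) :
    G.edgeFinset.card ≤ Δ * β + Δ / 2 * (β / ((Δ + 1) / 2)) := by
  classical
  obtain ⟨S, hS⟩ := exists_card_add_ncard_le_oddComponents hβ
  have hcard := Set.ncard_add_ncard_compl S
  have hW : Fintype.card (Sᶜ : Set V) = Sᶜ.ncard := by
    rw [← Nat.card_coe_set_eq, Nat.card_eq_fintype_card]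
  have hodd : (G.induce Sᶜ).oddComponents.ncard ≤ Fintype.card (Sᶜ : Set V) := by
    rw [← Nat.card_eq_fintype_card]
    exact (Set.ncard_le_card _).trans (Nat.card_le_card_of_surjective _ Quot.mk_surjective)
  rw [Nat.card_eq_fintype_card] at hcard
  obtain ⟨b, hb⟩ : ∃ b, β = S.ncard + b := Nat.exists_eq_add_of_le (by lia)
  have h2 := (G.induce Sᶜ).card_edgeFinset_le_of_oddComponents (b := b) (Δ := Δ)
    (fun v => ((Embedding.induce Sᶜ).toCopy.degree_le v).trans (hΔ _)) (by lia) h1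
  calc G.edgeFinset.card ≤ Δ * S.ncard + (G.induce Sᶜ).edgeFinset.card :=
        G.card_edgeFinset_le_induce_compl hΔ S
    _ ≤ Δ * S.ncard + (Δ * b + Δ / 2 * (b / ((Δ + 1) / 2))) := by gcongr
    _ = Δ * β + Δ / 2 * (b / ((Δ + 1) / 2)) := by rw [hb]; ring
    _ ≤ Δ * β + Δ / 2 * (β / ((Δ + 1) / 2)) := by
        gcongr
        lia

end SimpleGraph

/-- Chvátal–Hanson: the maximum number of edges of a simple graph with matching
number at most `β` and maximum degree at most `Δ` equals
`Δ*β + ⌊Δ/2⌋·⌊β/⌈Δ/2⌉⌋`, which is at most `Δ*β + β`. -/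
theorem chvatal_hanson (β Δ : ℕ) (hβ : 1 ≤ β) (hΔ : 1 ≤ Δ) :
    IsGreatest {m : ℕ | ∃ (n : ℕ) (G : SimpleGraph (Fin n)) (_ : DecidableRel G.Adj),
        (∀ M ⊆ G.edgeFinset,
          ((M : Set (Sym2 (Fin n))).Pairwise fun e f => ∀ v, ¬(v ∈ e ∧ v ∈ f)) →
          M.card ≤ β) ∧
        (∀ v, G.degree v ≤ Δ) ∧ m = G.edgeFinset.card}
      (Δ * β + (Δ / 2) * (β / ((Δ + 1) / 2)))
    ∧ Δ * β + (Δ / 2) * (β / ((Δ + 1) / 2)) ≤ Δ * β + β := by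
  refine ⟨⟨?_, ?_⟩, ?_⟩
  · classical
    obtain ⟨V, _, G, hG, hm⟩ := SimpleGraph.edgesAttainable_extremal β Δ
    let e : Fin (Nat.card V) ≃ V := (Finite.equivFin V).symm
    let φ : G ≃g G.comap e := (SimpleGraph.Iso.comap e G).symm
    have hH := hG.iso φ
    have hM : ∀ M ⊆ (G.comap e).edgeFinset,
        ((M : Set (Sym2 (Fin (Nat.card V)))).Pairwise fun e f => ∀ v, ¬(v ∈ e ∧ v ∈ f)) →
        M.card ≤ β :=
      fun M hM => hH.1 M fun x hx => SimpleGraph.mem_edgeFinset.1 (hM hx)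
    have hd : ∀ v, (G.comap e).degree v ≤ Δ := fun v => by
      rw [← SimpleGraph.card_neighborSet_eq_degree, ← Nat.card_eq_fintype_card,
        Nat.card_coe_set_eq]
      exact hH.2 v
    refine ⟨Nat.card V, G.comap e, inferInstance, hM, hd, le_antisymm ?_ ?_⟩
    · rw [← Nat.card_coe_set_eq, Nat.card_congr φ.mapEdgeSet, Nat.card_coe_set_eq,
        ← SimpleGraph.coe_edgeFinset, Set.ncard_coe_finset] at hm
      exact hm
    · exact SimpleGraph.card_edgeFinset_le_of_matching_of_degree _ hΔ hH.1 hd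
  · rintro _ ⟨n, G, _, hM, hd, rfl⟩
    exact G.card_edgeFinset_le_of_matching_of_degree hΔ
      (fun M hMG => hM M fun x hx => SimpleGraph.mem_edgeFinset.2 (hMG hx)) hd
  · gcongr
    calc Δ / 2 * (β / ((Δ + 1) / 2)) ≤ (Δ + 1) / 2 * (β / ((Δ + 1) / 2)) := by
          gcongr
          lia
      _ ≤ β := Nat.mul_div_le _ _
end

section
/- Every simple graph G with matching number at most β and maximum degree at most Δ satisfies e(G) ≤ Δβ + β. -/
/-- A finite set of pairwise disjoint edges of `G`. -/
def SimpleGraph.IsDisjointEdges {V : Type*} (G : SimpleGraph V) (M : Finset (Sym2 V)) : Prop :=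
  (∀ e ∈ M, e ∈ G.edgeSet) ∧ ∀ e ∈ M, ∀ f ∈ M, ∀ v, v ∈ e → v ∈ f → e = f

namespace SimpleGraph.IsDisjointEdges

variable {V : Type*} {G : SimpleGraph V} {M N : Finset (Sym2 V)}

theorem mono (hM : G.IsDisjointEdges M) (h : N ⊆ M) : G.IsDisjointEdges N :=
  ⟨fun e he => hM.1 e (h he), fun e he f hf => hM.2 e (h he) f (h hf)⟩

variable [DecidableEq V]

theorem insert_edge (hM : G.IsDisjointEdges M) {x y : V} (hxy : G.Adj x y)
    (hx : ∀ e ∈ M, x ∉ e) (hy : ∀ e ∈ M, y ∉ e) : G.IsDisjointEdges (insert s(x, y) M) := by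
  refine ⟨?_, ?_⟩
  · intro e he
    rcases Finset.mem_insert.1 he with rfl | he
    · exact hxy
    · exact hM.1 e he
  · intro e he f hf v hve hvf
    rcases Finset.mem_insert.1 he with rfl | heM <;>
      rcases Finset.mem_insert.1 hf with rfl | hfM
    · rfl
    · rcases Sym2.mem_iff.1 hve with rfl | rfl
      · exact (hx f hfM hvf).elim
      · exact (hy f hfM hvf).elim
    · rcases Sym2.mem_iff.1 hvf with rfl | rfl
      · exact (hx e heM hve).elim
      · exact (hy e heM hve).elim
    · exact hM.2 e heM f hfM v hve hvf

theorem card_biUnion_toFinset (hM : G.IsDisjointEdges M) :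
    (M.biUnion Sym2.toFinset).card = 2 * M.card := by
  rw [Finset.card_biUnion]
  · rw [Finset.sum_congr rfl fun e he =>
      Sym2.card_toFinset_of_not_isDiag e (G.not_isDiag_of_mem_edgeSet (hM.1 e he))]
    simp [mul_comm]
  · intro e he f hf hef
    rw [Function.onFun, Finset.disjoint_left]
    intro v hve hvf
    exact hef (hM.2 e he f hf v (Sym2.mem_toFinset.1 hve) (Sym2.mem_toFinset.1 hvf))

/-- The exchange argument behind Gallai's lemma: if no maximum matching misses both `u` and `t`,
nor both `v` and `t`, and some maximum matching `N` misses `t`, then no maximum matching `M` misses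
both `u` and `v`. -/
theorem false_of_missing_pair {β : ℕ} (hmax : ∀ M, G.IsDisjointEdges M → M.card ≤ β)
    {u v t : V} (huv : u ≠ v)
    (hu : ∀ N, G.IsDisjointEdges N → N.card = β → (∀ e ∈ N, t ∉ e) → ∃ e ∈ N, u ∈ e)
    (hv : ∀ N, G.IsDisjointEdges N → N.card = β → (∀ e ∈ N, t ∉ e) → ∃ e ∈ N, v ∈ e)
    (hM : G.IsDisjointEdges M) (hMc : M.card = β)
    (hMu : ∀ e ∈ M, u ∉ e) (hMv : ∀ e ∈ M, v ∉ e)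
    (hN : G.IsDisjointEdges N) (hNc : N.card = β) (hNt : ∀ e ∈ N, t ∉ e) : False := by
  induction hk : (M \ N).card using Nat.strong_induction_on generalizing N with
  | _ k ih =>
  subst hk
  set A := M.biUnion Sym2.toFinset with hA
  set B := N.biUnion Sym2.toFinset with hB
  have memA : ∀ w, w ∈ A ↔ ∃ e ∈ M, w ∈ e := by simp [hA]
  have memB : ∀ w, w ∈ B ↔ ∃ e ∈ N, w ∈ e := by simp [hB]
  have hAB : A.card = B.card := by
    rw [hM.card_biUnion_toFinset, hN.card_biUnion_toFinset, hMc, hNc]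
  have hsub : ({u, v} : Finset V) ⊆ B \ A := by
    intro w hw
    rw [Finset.mem_sdiff, memA, memB]
    rcases Finset.mem_insert.1 hw with rfl | hw
    · exact ⟨hu N hN hNc hNt, fun ⟨e, he, h⟩ => hMu e he h⟩
    · obtain rfl := Finset.mem_singleton.1 hw
      exact ⟨hv N hN hNc hNt, fun ⟨e, he, h⟩ => hMv e he h⟩
  have hcard : 1 < (A \ B).card := by
    rw [Finset.card_sdiff_comm hAB]
    have := Finset.card_le_card hsub
    rw [Finset.card_pair huv] at this
    omega
  obtain ⟨x, hx, hxt⟩ := Finset.exists_mem_ne hcard t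
  rw [Finset.mem_sdiff, memA, memB] at hx
  obtain ⟨⟨e, heM, hxe⟩, hxN⟩ := hx
  obtain ⟨y, rfl⟩ := Sym2.mem_iff_exists.1 hxe
  have hxy : G.Adj x y := hM.1 _ heM
  have hxN' : ∀ e ∈ N, x ∉ e := fun e he h => hxN ⟨e, he, h⟩
  have hnotN : s(x, y) ∉ N := fun h => hxN' _ h hxe
  by_cases hy : ∃ f ∈ N, y ∈ f
  · obtain ⟨f, hfN, hyf⟩ := hy
    have hyt : y ≠ t := by
      rintro rfl
      exact hNt f hfN hyf
    have hfM : f ∉ M := by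
      intro hfM
      have := hM.2 _ heM f hfM y (Sym2.mem_mk_right x y) hyf
      exact hnotN (this ▸ hfN)
    have hnotE : s(x, y) ∉ N.erase f := fun h => hnotN (Finset.mem_of_mem_erase h)
    refine ih _ ?_ (N := insert s(x, y) (N.erase f)) ?_ ?_ ?_ rfl
    · apply Finset.card_lt_card
      rw [Finset.ssubset_iff_of_subset]
      · exact ⟨s(x, y), by simp [heM, hnotN], by simp⟩
      · intro g hg
        rw [Finset.mem_sdiff] at hg ⊢
        refine ⟨hg.1, fun hgN => hg.2 (Finset.mem_insert_of_mem (Finset.mem_erase.2 ⟨?_, hgN⟩))⟩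
        rintro rfl
        exact hfM hg.1
    · refine (hN.mono (Finset.erase_subset f N)).insert_edge hxy
        (fun e he => hxN' e (Finset.mem_of_mem_erase he)) ?_
      intro e he hye
      exact Finset.ne_of_mem_erase he (hN.2 e (Finset.mem_of_mem_erase he) f hfN y hye hyf)
    · rw [Finset.card_insert_of_notMem hnotE, Finset.card_erase_add_one hfN, hNc]
    · intro e he hte
      rcases Finset.mem_insert.1 he with rfl | he
      · rcases Sym2.mem_iff.1 hte with h | h
        · exact hxt h.symm
        · exact hyt h.symm
      · exact hNt e (Finset.mem_of_mem_erase he) hte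
  · have h := hmax _ (hN.insert_edge hxy hxN' fun e he h => hy ⟨e, he, h⟩)
    rw [Finset.card_insert_of_notMem hnotN] at h
    omega

end SimpleGraph.IsDisjointEdges

/-- If every vertex is missed by some matching of maximum size `β`, then the vertices are
partitioned into classes closed under adjacency such that a maximum matching misses at most one
vertex of each class; this bounds the degree sum. -/
theorem SimpleGraph.sum_degrees_le_of_forall_missed {V : Type*} [Fintype V] [DecidableEq V]
    (G : SimpleGraph V) [DecidableRel G.Adj] {β Δ : ℕ}
    (hmax : ∀ M, G.IsDisjointEdges M → M.card ≤ β)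
    (hmiss : ∀ v, ∃ M, G.IsDisjointEdges M ∧ M.card = β ∧ ∀ e ∈ M, v ∉ e)
    (hdeg : ∀ v, G.degree v ≤ Δ) :
    ∑ v, G.degree v ≤ (Δ + 1) * (2 * β) := by
  classical
  rcases isEmpty_or_nonempty V with hV | ⟨⟨v₀⟩⟩
  · simp
  let S : Setoid V :=
    { r := fun u v => u = v ∨
        ∀ N, G.IsDisjointEdges N → N.card = β → (∀ e ∈ N, u ∉ e) → ∃ e ∈ N, v ∈ e
      iseqv :=
        { refl := fun _ => Or.inl rfl
          symm := by
            rintro u v (rfl | h)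
            · exact Or.inl rfl
            · refine Or.inr fun N hN hc hv => ?_
              by_contra! hu
              obtain ⟨e, he, hve⟩ := h N hN hc hu
              exact hv e he hve
          trans := by
            rintro u t v (rfl | hut) htv
            · exact htv
            rcases htv with rfl | htv
            · exact Or.inr hut
            by_cases huv : u = v
            · exact Or.inl huv
            refine Or.inr fun M hM hMc hMu => ?_
            by_contra! hMv
            obtain ⟨N, hN, hNc, hNt⟩ := hmiss t
            refine SimpleGraph.IsDisjointEdges.false_of_missing_pair hmax huv ?_ htv
              hM hMc hMu hMv hN hNc hNt
            intro N hN hNc hNt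
            by_contra! hNu
            obtain ⟨e, he, hte⟩ := hut N hN hNc hNu
            exact hNt e he hte } }
  let q : V → Quotient S := Quotient.mk S
  let C : Quotient S → Finset V := fun c => Finset.univ.filter fun v => q v = c
  have hadj : ∀ u v, G.Adj u v → q u = q v := by
    intro u v huv
    refine Quotient.sound (Or.inr fun N hN hc hu => ?_)
    by_contra! hv
    have h := hmax _ (hN.insert_edge huv hu hv)
    rw [Finset.card_insert_of_notMem fun h => hu _ h (Sym2.mem_mk_left u v)] at h
    omega
  have hpos : ∀ c, 1 ≤ (C c).card := by
    intro c
    obtain ⟨v, rfl⟩ := Quotient.exists_rep c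
    exact Finset.card_pos.2 ⟨v, by simp [C, q]⟩
  have hdegC : ∀ v, G.degree v + 1 ≤ (C (q v)).card := by
    intro v
    rw [← G.card_neighborFinset_eq_degree,
      ← Finset.card_insert_of_notMem (G.notMem_neighborFinset_self v)]
    apply Finset.card_le_card
    intro w hw
    rcases Finset.mem_insert.1 hw with rfl | hw
    · simp [C]
    · simpa [C] using (hadj v w ((G.mem_neighborFinset v w).1 hw)).symm
  have hclass : ∀ c, ∑ v ∈ C c, G.degree v + (Δ + 1) ≤ (Δ + 1) * (C c).card := by
    intro c
    have h1 : ∀ v ∈ C c, G.degree v ≤ min Δ ((C c).card - 1) := by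
      intro v hv
      have hvc : q v = c := by simpa [C] using hv
      have := hdegC v
      rw [hvc] at this
      exact le_min (hdeg v) (by omega)
    have h2 := Finset.sum_le_card_nsmul _ _ _ h1
    obtain ⟨n, hn⟩ := Nat.exists_eq_add_of_le' (hpos c)
    rw [hn, smul_eq_mul, Nat.add_sub_cancel] at h2
    rw [hn]
    rcases le_total Δ n with h | h
    · rw [min_eq_left h] at h2
      nlinarith
    · rw [min_eq_right h] at h2
      nlinarith
  have hsum : ∑ v, G.degree v + (Δ + 1) * Fintype.card (Quotient S)
      ≤ (Δ + 1) * Fintype.card V := by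
    have h := Finset.sum_le_sum fun c (_ : c ∈ Finset.univ) => hclass c
    rw [Finset.sum_add_distrib, Finset.sum_fiberwise, ← Finset.mul_sum,
      ← Finset.card_eq_sum_card_fiberwise (fun _ _ => Finset.mem_coe.2 (Finset.mem_univ _))] at h
    simpa [mul_comm] using h
  obtain ⟨M, hM, hMc, -⟩ := hmiss v₀
  have hun : (M.biUnion Sym2.toFinset)ᶜ.card ≤ Fintype.card (Quotient S) := by
    refine Finset.card_le_card_of_injOn q (fun _ _ => Finset.mem_coe.2 (Finset.mem_univ _)) ?_
    intro u hu v hv huv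
    have hu' : ∀ e ∈ M, u ∉ e := by simpa using hu
    have hv' : ∀ e ∈ M, v ∉ e := by simpa using hv
    rcases Quotient.exact huv with h | h
    · exact h
    · obtain ⟨e, he, hve⟩ := h M hM hMc hu'
      exact (hv' e he hve).elim
  have hcompl := Finset.card_add_card_compl (M.biUnion Sym2.toFinset)
  rw [hM.card_biUnion_toFinset, hMc] at hcompl
  have hle : Fintype.card V ≤ 2 * β + Fintype.card (Quotient S) := by omega
  have := Nat.mul_le_mul_left (Δ + 1) hle
  rw [mul_add] at this
  omega

theorem SimpleGraph.card_edgeFinset_le_of_isDisjointEdges {V : Type*} [Fintype V] [DecidableEq V]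
    {Δ : ℕ} (β : ℕ) (G : SimpleGraph V) [DecidableRel G.Adj]
    (hmax : ∀ M, G.IsDisjointEdges M → M.card ≤ β) (hdeg : ∀ v, G.degree v ≤ Δ) :
    G.edgeFinset.card ≤ (Δ + 1) * β := by
  classical
  induction β generalizing G with
  | zero =>
    by_contra! h
    obtain ⟨e, he⟩ := Finset.card_pos.1 (Nat.pos_of_ne_zero (by omega : G.edgeFinset.card ≠ 0))
    have := hmax {e} ⟨by simpa using he, by simp⟩
    simp at this
  | succ β ih =>
    by_cases hmiss : ∀ v, ∃ M, G.IsDisjointEdges M ∧ M.card = β + 1 ∧ ∀ e ∈ M, v ∉ e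
    · have h := G.sum_degrees_le_of_forall_missed hmax hmiss hdeg
      rw [G.sum_degrees_eq_twice_card_edges] at h
      linarith
    · push Not at hmiss
      obtain ⟨v, hv⟩ := hmiss
      have h := ih (G.deleteIncidenceSet v) ?_ ?_
      · rw [G.card_edgeFinset_deleteIncidenceSet v] at h
        have := hdeg v
        rw [mul_add, mul_one]
        omega
      · intro M hM
        have hmem : ∀ e ∈ M, e ∈ G.edgeSet ∧ v ∉ e := by
          intro e he
          have := hM.1 e he
          rw [G.edgeSet_deleteIncidenceSet v] at this
          exact ⟨this.1, fun h => this.2 ⟨this.1, h⟩⟩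
        have hMG : G.IsDisjointEdges M := ⟨fun e he => (hmem e he).1, hM.2⟩
        have hne : M.card ≠ β + 1 := by
          intro hc
          obtain ⟨e, he, hve⟩ := hv M hMG hc
          exact (hmem e he).2 hve
        have := hmax M hMG
        omega
      · exact fun w => (SimpleGraph.degree_le_of_le (G.deleteIncidenceSet_le v)).trans (hdeg w)

theorem edges_le_of_matching_and_degree {V : Type*} [Fintype V] [DecidableEq V]
    (G : SimpleGraph V) [DecidableRel G.Adj] (β Δ : ℕ) (hβ : 1 ≤ β) (hΔ : 1 ≤ Δ)
    (hmatch : ∀ M ⊆ G.edgeFinset,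
      ((M : Set (Sym2 V)).Pairwise fun e f => ∀ v, ¬(v ∈ e ∧ v ∈ f)) → M.card ≤ β)
    (hdeg : ∀ v, G.degree v ≤ Δ) :
    G.edgeFinset.card ≤ Δ * β + β := by
  have h := G.card_edgeFinset_le_of_isDisjointEdges β (fun M hM => hmatch M
    (fun e he => SimpleGraph.mem_edgeFinset.2 (hM.1 e he))
    fun e he f hf hef v hv => hef (hM.2 e he f hf v hv.1 hv.2)) hdeg
  rwa [Nat.succ_mul] at h
end
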